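/- For n ≥ 2, the left multiplication group of the K-loop (L_G, ∘) of positive definite hermitian n×n complex matrices of determinant 1 (operation from polar decomposition in SL(n,ℂ)) is isomorphic to PSL(n, ℂ). -/

import Mathlib

/-- A loop: a binary operation with two-sided identity whose left and right
translations are bijections. -/
structure LoopStr (L : Type*) where
  mul : L → L → L
  one : L
  one_mul : ∀ x, mul one x = x
  mul_one : ∀ x, mul x one = x
  mul_left_bij : ∀ x, Function.Bijective (mul x)
  mul_right_bij : ∀ x, Function.Bijective fun y => mul y x

/-- Left translation `λ_x` as a permutation. -/
noncomputable def LoopStr.lam {L : Type*} (S : LoopStr L) (x : L) : Equiv.Perm L :=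
  Equiv.ofBijective _ (S.mul_left_bij x)

/-- Right translation `ρ_x` as a permutation. -/
noncomputable def LoopStr.rho {L : Type*} (S : LoopStr L) (x : L) : Equiv.Perm L :=
  Equiv.ofBijective _ (S.mul_right_bij x)

/-- The left multiplication group `Mlt_ℓ(L)`. -/
noncomputable def LoopStr.Mlt {L : Type*} (S : LoopStr L) : Subgroup (Equiv.Perm L) :=
  Subgroup.closure (Set.range S.lam)

/-- Left division: `ldiv a b` is the unique solution `x` of `a·x = b`. -/
noncomputable def LoopStr.ldiv {L : Type*} (S : LoopStr L) (a b : L) : L := (S.lam a).symm b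

/-- Right division: `rdiv a b` is the unique solution `x` of `x·b = a`. -/
noncomputable def LoopStr.rdiv {L : Type*} (S : LoopStr L) (a b : L) : L := (S.rho b).symm a

/-- The inner mapping `δ_{x,y} = λ_{xy}⁻¹ ∘ λ_x ∘ λ_y`. -/
noncomputable def LoopStr.delta {L : Type*} (S : LoopStr L) (x y : L) : Equiv.Perm L :=
  (S.lam (S.mul x y))⁻¹ * S.lam x * S.lam y

/-- A loop homomorphism: preserves the multiplication and the identity. -/
def IsLoopHom {L L' : Type*} (S : LoopStr L) (S' : LoopStr L') (θ : L → L') : Prop :=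
  θ S.one = S'.one ∧ ∀ x y, θ (S.mul x y) = S'.mul (θ x) (θ y)

/-- A subloop: a subset containing the identity, closed under multiplication
and both divisions. -/
def IsSubloop {L : Type*} (S : LoopStr L) (N : Set L) : Prop :=
  S.one ∈ N ∧ (∀ a ∈ N, ∀ b ∈ N, S.mul a b ∈ N) ∧
    (∀ a ∈ N, ∀ b ∈ N, S.ldiv a b ∈ N) ∧ (∀ a ∈ N, ∀ b ∈ N, S.rdiv a b ∈ N)

/-- A normal subloop: `ab·N = a·(bN) = (aN)·b` for all `a, b`. -/
def IsNormalSubloop {L : Type*} (S : LoopStr L) (N : Set L) : Prop :=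
  IsSubloop S N ∧ ∀ a b : L,
    ((fun n => S.mul (S.mul a b) n) '' N = (fun n => S.mul a (S.mul b n)) '' N) ∧
    ((fun n => S.mul (S.mul a b) n) '' N = (fun n => S.mul (S.mul a n) b) '' N)

open scoped ComplexOrder

/-- The special unitary group `SU(n)`, as a set of matrices. -/
def SU (n : ℕ) : Set (Matrix (Fin n) (Fin n) ℂ) :=
  {u | u ∈ Matrix.unitaryGroup (Fin n) ℂ ∧ u.det = 1}

/-- The positive definite hermitian complex `n × n` matrices of determinant 1,
as a type. -/
def LGt (n : ℕ) : Type :=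
  {A : Matrix (Fin n) (Fin n) ℂ // A.PosDef ∧ A.det = 1}

/-- The underlying matrix of an element of `LGt n`. -/
def LGt.mat {n : ℕ} (A : LGt n) : Matrix (Fin n) (Fin n) ℂ := A.val

namespace Matrix.SpecialLinearGroup

variable {ι F : Type*} [Fintype ι] [DecidableEq ι] [Field F]

lemma diag2n_eq_one_add {i j : ι} (hij : i ≠ j) (a : F) (ha : a ≠ 0) :
    (diag2n hij a ha : Matrix ι ι F) = 1 + single i i (a - 1) + single j j (a⁻¹ - 1) := by
  ext k l
  simp only [diag2n_coe, diagonal_apply, add_apply, one_apply, single_apply]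
  grind

/-- In any dimension, `diag(a, a⁻¹)` is a product of transvections. -/
lemma diag2n_decompose {i j : ι} (hij : i ≠ j) (a : F) (ha : a ≠ 0) :
    diag2n hij a ha =
      (transvection hij a * transvection hij.symm (-a⁻¹) * transvection hij a) *
      (transvection hij (-1) * transvection hij.symm 1 * transvection hij (-1)) := by
  have weyl (b c : F) (hbc : b * c = -1) :
      ((transvection hij b * transvection hij.symm c * transvection hij b :
        SpecialLinearGroup ι F) : Matrix ι ι F) =
      1 + single i i (-1) + single j j (-1) + single i j b + single j i c := by
    simp only [coe_mul, transvection_coe, mul_add, add_mul, mul_one, one_mul,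
      single_mul_single_same, single_mul_single_of_ne _ _ _ _ hij.symm, hbc, mul_comm c b]
    ext k l
    simp only [add_apply, single_apply, zero_apply]
    grind
  apply Subtype.ext
  rw [coe_mul, weyl a (-a⁻¹) (by field_simp), weyl (-1) 1 (by ring), diag2n_eq_one_add]
  simp only [mul_add, add_mul, mul_one, one_mul,
    single_mul_single_same, single_mul_single_of_ne _ _ _ _ hij,
    single_mul_single_of_ne _ _ _ _ hij.symm]
  ext k l
  simp only [add_apply, single_apply, zero_apply]
  grind

/-- The transvections generate the special linear group. -/
lemma eq_top_of_transvection_mem [Nontrivial ι] (H : Subgroup (SpecialLinearGroup ι F))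
    (h : ∀ (i j : ι) (hij : i ≠ j) (c : F), transvection hij c ∈ H) : H = ⊤ := by
  refine (Subgroup.eq_top_iff' H).2 fun g ↦
    diagonal_transvection_induction' (· ∈ H) g (fun i j hij c hc ↦ ?_) h fun _ _ ↦ H.mul_mem
  rw [diag2n_decompose]
  exact H.mul_mem (H.mul_mem (H.mul_mem (h ..) (h ..)) (h ..))
    (H.mul_mem (H.mul_mem (h ..) (h ..)) (h ..))

lemma diag2n_mul_transvection {i j : ι} (hij : i ≠ j) (a : F) (ha : a ≠ 0) (b : F) :
    diag2n hij a ha * transvection hij b =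
      transvection hij (a ^ 2 * b) * diag2n hij a ha := by
  apply Subtype.ext
  simp only [coe_mul, transvection_coe, diag2n_eq_one_add, mul_add, add_mul, mul_one, one_mul,
    single_mul_single_same, single_mul_single_of_ne _ _ _ _ hij.symm]
  ext k l
  simp only [add_apply, single_apply, zero_apply]
  grind

lemma isUnit_coe (g : SpecialLinearGroup ι F) : IsUnit (g : Matrix ι ι F) :=
  (isUnit_iff_isUnit_det _).2 (by simp)

/-- The positive definite hermitian matrices of determinant `1` generate `SL(n, ℂ)`. -/
lemma eq_top_of_posDef_mem [Nontrivial ι] (H : Subgroup (SpecialLinearGroup ι ℂ))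
    (h : ∀ g : SpecialLinearGroup ι ℂ, (g : Matrix ι ι ℂ).PosDef → g ∈ H) : H = ⊤ := by
  refine eq_top_of_transvection_mem H fun i j hij c ↦ ?_
  set D := diag2n hij (2 : ℂ) two_ne_zero with hD
  set T := transvection hij (c / 3)
  have hDpos : (D : Matrix ι ι ℂ).PosDef := by
    rw [hD, diag2n_coe]
    refine .diagonal fun k ↦ ?_
    split_ifs <;> norm_num
  let Ts : SpecialLinearGroup ι ℂ := ⟨(T : Matrix ι ι ℂ)ᴴ, by simp [det_conjTranspose]⟩
  have hTT : T * Ts ∈ H := h _ <| by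
    have := (IsUnit.posDef_star_right_conjugate_iff T.isUnit_coe).2 (PosDef.one (R := ℂ))
    rwa [mul_one] at this
  have hTDT : T * D * Ts ∈ H :=
    h _ ((IsUnit.posDef_star_right_conjugate_iff T.isUnit_coe).2 hDpos)
  have hconj : T * D * T⁻¹ ∈ H := by
    simpa [mul_assoc] using H.mul_mem hTDT (H.inv_mem hTT)
  have hc : transvection hij c = D * (T * D * T⁻¹)⁻¹ := by
    have h1 : T * transvection hij c = transvection hij (2 ^ 2 * (c / 3)) := by
      rw [← transvection_add]
      congr 1
      ring
    have h2 : T * transvection hij c = transvection hij c * T := by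
      rw [← transvection_add, ← transvection_add, add_comm]
    have h3 := diag2n_mul_transvection hij (2 : ℂ) two_ne_zero (c / 3)
    rw [← h1, h2] at h3
    rw [_root_.mul_inv_rev, inv_inv, _root_.mul_inv_rev, ← mul_assoc, ← mul_assoc, eq_mul_inv_iff_mul_eq,
      eq_mul_inv_iff_mul_eq]
    exact h3.symm
  exact hc ▸ H.mul_mem (h _ hDpos) (H.inv_mem hconj)

end Matrix.SpecialLinearGroup

namespace LGt

open Matrix

variable {n : ℕ}

lemma mat_injective : Function.Injective (mat : LGt n → _) := Subtype.val_injective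

lemma posDef_mat (A : LGt n) : A.mat.PosDef := A.2.1

lemma det_mat (A : LGt n) : A.mat.det = 1 := A.2.2

/-- The inclusion of `LGt n` in the special linear group. -/
def toSL (A : LGt n) : SpecialLinearGroup (Fin n) ℂ := ⟨A.mat, A.det_mat⟩

/-- The action `X ↦ g X gᴴ` of the special linear group on `LGt n`. -/
def conj (g : SpecialLinearGroup (Fin n) ℂ) (X : LGt n) : LGt n :=
  ⟨g.1 * X.mat * g.1ᴴ, (IsUnit.posDef_star_right_conjugate_iff g.isUnit_coe).2 X.posDef_mat, by
    simp [det_conjTranspose, X.det_mat]⟩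

lemma conj_mat (g : SpecialLinearGroup (Fin n) ℂ) (X : LGt n) :
    (conj g X).mat = g.1 * X.mat * g.1ᴴ := rfl

/-- The action `X ↦ g X gᴴ` as a permutation representation. -/
def conjHom : SpecialLinearGroup (Fin n) ℂ →* Equiv.Perm (LGt n) :=
  letI : MulAction (SpecialLinearGroup (Fin n) ℂ) (LGt n) :=
    { smul := conj
      one_smul := fun X ↦ mat_injective (by
        change (conj 1 X).mat = _
        simp [conj_mat])
      mul_smul := fun g h X ↦ mat_injective (by
        change (conj (g * h) X).mat = (conj g (conj h X)).mat
        simp [conj_mat, mul_assoc]) }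
  MulAction.toPermHom _ _

lemma conjHom_apply (g : SpecialLinearGroup (Fin n) ℂ) (X : LGt n) :
    conjHom g X = conj g X := rfl

/-- The identity matrix as an element of `LGt n`. -/
def one : LGt n := ⟨1, .one, det_one⟩

lemma conj_toSL_one_mat (A : LGt n) : (conj A.toSL one).mat = A.mat * A.mat := by
  change A.mat * 1 * A.matᴴ = _
  rw [mul_one, A.posDef_mat.isHermitian.eq]

open scoped MatrixOrder Matrix.Norms.L2Operator in
/-- Squaring is a bijection of the positive definite matrices of determinant `1`. -/
noncomputable def sqEquiv : LGt n ≃ LGt n :=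
  Equiv.ofBijective (fun A ↦ conj A.toSL one) <| by
    refine ⟨fun A B h ↦ ?_, fun X ↦ ?_⟩
    · have h' := congrArg mat h
      simp only [conj_toSL_one_mat] at h'
      apply mat_injective
      rw [← CFC.sqrt_mul_self A.mat (nonneg_iff_posSemidef.2 A.posDef_mat.posSemidef), h',
        CFC.sqrt_mul_self B.mat (nonneg_iff_posSemidef.2 B.posDef_mat.posSemidef)]
    · have hdet : (CFC.sqrt X.mat).det = 1 := by
        simp [X.posDef_mat.posSemidef.det_sqrt, X.det_mat]
      have hpos : (CFC.sqrt X.mat).PosDef := by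
        rw [PosSemidef.posDef_iff_det_ne_zero (nonneg_iff_posSemidef.1 (CFC.sqrt_nonneg _)), hdet]
        exact one_ne_zero
      exact ⟨⟨CFC.sqrt X.mat, hpos, hdet⟩, mat_injective <| (conj_toSL_one_mat _).trans <|
        CFC.sqrt_mul_sqrt_self _ (nonneg_iff_posSemidef.2 X.posDef_mat.posSemidef)⟩

lemma sqEquiv_mat (A : LGt n) : (sqEquiv A).mat = A.mat * A.matᴴ := by
  change A.mat * 1 * A.matᴴ = _
  rw [mul_one]

/-- The action of the special linear group on `LGt n` by polar decomposition:
`polarHom g B` is the positive definite part of `g B`. -/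
noncomputable def polarHom : SpecialLinearGroup (Fin n) ℂ →* Equiv.Perm (LGt n) :=
  sqEquiv.symm.permCongrHom.toMonoidHom.comp conjHom

lemma sqEquiv_polarHom (g : SpecialLinearGroup (Fin n) ℂ) (B : LGt n) :
    sqEquiv (polarHom g B) = conj g (sqEquiv B) := by
  simp [polarHom, Equiv.permCongrHom, conjHom_apply]

lemma polarHom_toSL {S : LoopStr (LGt n)}
    (hmul : ∀ A B : LGt n, ∃ u ∈ SU n, A.mat * B.mat = (S.mul A B).mat * u) (A : LGt n) :
    polarHom A.toSL = S.lam A := by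
  ext B
  apply sqEquiv.injective
  apply mat_injective
  obtain ⟨u, ⟨hu, -⟩, h⟩ := hmul A B
  rw [sqEquiv_polarHom]
  change A.mat * (sqEquiv B).mat * A.matᴴ = (sqEquiv (S.mul A B)).mat
  rw [sqEquiv_mat, sqEquiv_mat]
  calc A.mat * (B.mat * B.matᴴ) * A.matᴴ = (A.mat * B.mat) * (A.mat * B.mat)ᴴ := by
        simp only [conjTranspose_mul, mul_assoc]
    _ = (S.mul A B).mat * (u * star u) * (S.mul A B).matᴴ := by
        rw [h, conjTranspose_mul, star_eq_conjTranspose]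
        simp only [mul_assoc]
    _ = _ := by rw [mem_unitaryGroup_iff.1 hu, mul_one]

lemma closure_range_toSL [Nontrivial (Fin n)] :
    Subgroup.closure (Set.range (toSL : LGt n → _)) = ⊤ :=
  SpecialLinearGroup.eq_top_of_posDef_mem _ fun g hg ↦
    Subgroup.subset_closure ⟨⟨g.1, hg, g.2⟩, rfl⟩

lemma mem_ker_polarHom_iff (g : SpecialLinearGroup (Fin n) ℂ) :
    g ∈ polarHom.ker ↔ ∀ X : LGt n, conj g X = X := by
  rw [MonoidHom.mem_ker, Equiv.ext_iff]
  constructor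
  · intro h X
    obtain ⟨B, rfl⟩ := sqEquiv.surjective X
    rw [← sqEquiv_polarHom, h, Equiv.Perm.one_apply]
  · intro h B
    apply sqEquiv.injective
    rw [sqEquiv_polarHom, h, Equiv.Perm.one_apply]

lemma ker_polarHom (hn : 2 ≤ n) :
    (polarHom (n := n)).ker = Subgroup.center (SpecialLinearGroup (Fin n) ℂ) := by
  have : Nontrivial (Fin n) := Fin.nontrivial_iff_two_le.2 hn
  ext g
  rw [mem_ker_polarHom_iff]
  constructor
  · intro h
    have hunit : g.1ᴴ * g.1 = 1 := by
      have h1 := congrArg mat (h one)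
      rw [conj_mat] at h1
      exact mul_eq_one_comm.1 (by simpa [one, mat] using h1)
    have hcomm (A : LGt n) : A.toSL ∈ Subgroup.centralizer {g} := by
      rw [Subgroup.mem_centralizer_singleton_iff]
      apply Subtype.ext
      have hA := congrArg mat (h A)
      rw [conj_mat] at hA
      change A.mat * g.1 = g.1 * A.mat
      conv_lhs => rw [← hA]
      rw [mul_assoc _ g.1ᴴ, hunit, mul_one]
    have htop : Subgroup.centralizer {g} = ⊤ := by
      rw [eq_top_iff, ← closure_range_toSL, Subgroup.closure_le]
      rintro _ ⟨A, rfl⟩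
      exact hcomm A
    rw [Subgroup.centralizer_eq_top_iff_subset] at htop
    exact htop rfl
  · intro hg X
    obtain ⟨r, hr, hrg⟩ := Matrix.SpecialLinearGroup.mem_center_iff.1 hg
    have hnorm : r * star r = 1 := by
      have : ‖r‖ = 1 := Complex.norm_eq_one_of_pow_eq_one hr (by simp; omega)
      simp [Complex.mul_conj, Complex.normSq_eq_norm_sq, this]
    apply mat_injective
    rw [conj_mat, ← hrg]
    simp only [scalar_apply, ← smul_one_eq_diagonal, conjTranspose_smul, conjTranspose_one,
      Matrix.smul_mul, one_mul, Matrix.mul_smul, mul_one, smul_smul]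
    rw [mul_comm, hnorm, one_smul]

lemma range_polarHom (hn : 2 ≤ n) {S : LoopStr (LGt n)}
    (hmul : ∀ A B : LGt n, ∃ u ∈ SU n, A.mat * B.mat = (S.mul A B).mat * u) :
    polarHom.range = S.Mlt := by
  have : Nontrivial (Fin n) := Fin.nontrivial_iff_two_le.2 hn
  rw [MonoidHom.range_eq_map, ← closure_range_toSL, MonoidHom.map_closure, ← Set.range_comp,
    LoopStr.Mlt]
  congr 2
  exact funext fun A ↦ polarHom_toSL hmul A

end LGt

/-- For `n ≥ 2`, the left multiplication group of the K-loop
of positive definite hermitian `n × n` complex determinant-1 matrices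
(operation from polar decomposition in `SL(n, ℂ)`) is isomorphic to
`PSL(n, ℂ) = SL(n, ℂ)/Z(SL(n, ℂ))`. -/
theorem stmt16 (n : ℕ) (hn : 2 ≤ n) (S : LoopStr (LGt n)) (hone : S.one.mat = 1)
    (hmul : ∀ A B : LGt n, ∃ u ∈ SU n, A.mat * B.mat = (S.mul A B).mat * u) :
    Nonempty (↥S.Mlt ≃*
      (Matrix.SpecialLinearGroup (Fin n) ℂ ⧸
        Subgroup.center (Matrix.SpecialLinearGroup (Fin n) ℂ))) := by
  exact ⟨(MulEquiv.subgroupCongr (LGt.range_polarHom hn hmul)).symm.trans <|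
    (QuotientGroup.quotientKerEquivRange _).symm.trans <|
      QuotientGroup.quotientMulEquivOfEq (LGt.ker_polarHom hn)⟩
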